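/- arXiv:1803.03769 — 6 statements merged into one kernel-verified Lean document; each statement's English description precedes it below -/
import Mathlib

section
/- Let l be a surrogate loss (a measurable function l : ℝ → [0, ∞) with l(z) ≥ 1{z ≥ 0} + 1{z ≥ 1} for all z ∈ ℝ). Then for every measurable predictor h : X → ℝ, the expected conditional-difference loss is bounded by the maximum of the treatment and reweighted control surrogate risks: E[l₁](h) ≤ max( R_T(l, h), R_C(l, h) ). -/
open MeasureTheory

/-- **Theorem (surrogate upper bound for the conditional-difference loss `l₁`).**
`E[l₁](h) ≤ max (R_T(l,h)) (R_C(l,h))` for any surrogate loss `l` with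
`l z ≥ 1{z ≥ 0} + 1{z ≥ 1}`. -/
theorem expected_l1_le_max_surrogate_risks
    {X : Type*} [MeasurableSpace X] (μT : Measure X) [IsProbabilityMeasure μT]
    (pT pC : X → ℝ) (hpT : Measurable pT) (hpC : Measurable pC)
    (hpT0 : ∀ x, 0 ≤ pT x) (hpT1 : ∀ x, pT x ≤ 1)
    (hpC0 : ∀ x, 0 ≤ pC x) (hpC1 : ∀ x, pC x ≤ 1)
    (l : ℝ → ℝ) (hl : Measurable l) (hl0 : ∀ z, 0 ≤ l z)
    (hsur : ∀ z : ℝ, (if (0:ℝ) ≤ z then (1:ℝ) else 0) + (if (1:ℝ) ≤ z then (1:ℝ) else 0) ≤ l z)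
    (h : X → ℝ) (hh : Measurable h) :
    (∫⁻ x, ENNReal.ofReal
        ((pT x * pC x + (1 - pT x) * (1 - pC x)) * (if (1:ℝ) ≤ |h x| then 1 else 0)
          + pT x * (1 - pC x) * (if h x ≤ -1 then 1 else 0)
          + (1 - pT x) * pC x * (if (1:ℝ) ≤ h x then 1 else 0)) ∂μT)
      ≤ max
        (∫⁻ x, ENNReal.ofReal (pT x * l (-(h x)) + (1 - pT x) * l (h x)) ∂μT)
        (∫⁻ x, ENNReal.ofReal (pC x * l (h x) + (1 - pC x) * l (-(h x))) ∂μT) := by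
  have key : ∀ x, 2 * ((pT x * pC x + (1 - pT x) * (1 - pC x)) * (if (1:ℝ) ≤ |h x| then 1 else 0)
          + pT x * (1 - pC x) * (if h x ≤ -1 then 1 else 0)
          + (1 - pT x) * pC x * (if (1:ℝ) ≤ h x then 1 else 0))
      ≤ (pT x * l (-(h x)) + (1 - pT x) * l (h x))
        + (pC x * l (h x) + (1 - pC x) * l (-(h x))) := by
    intro x
    have a0 := hpT0 x
    have a1 : 0 ≤ 1 - pT x := sub_nonneg.2 (hpT1 x)
    have c0 := hpC0 x
    have c1 : 0 ≤ 1 - pC x := sub_nonneg.2 (hpC1 x)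
    have u0 := hl0 (h x)
    have v0 := hl0 (-(h x))
    by_cases h1 : 1 ≤ h x
    · have e1 : 1 ≤ |h x| := h1.trans (le_abs_self _)
      have e2 : ¬ h x ≤ -1 := by linarith
      have hs := hsur (h x)
      have h0 : 0 ≤ h x := by linarith
      rw [if_pos h0, if_pos h1] at hs
      rw [if_pos e1, if_neg e2, if_pos h1]
      nlinarith [mul_nonneg a0 v0, mul_nonneg c1 v0, mul_nonneg a1 (sub_nonneg.2 hs),
        mul_nonneg c0 (sub_nonneg.2 hs), mul_nonneg c0 a1]
    · by_cases h2 : h x ≤ -1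
      · have e1 : 1 ≤ |h x| := le_trans (by linarith) (neg_le_abs _)
        have hs := hsur (-(h x))
        have h0 : 0 ≤ -(h x) := by linarith
        have h3 : 1 ≤ -(h x) := by linarith
        rw [if_pos h0, if_pos h3] at hs
        rw [if_pos e1, if_pos h2, if_neg h1]
        nlinarith [mul_nonneg a1 u0, mul_nonneg c0 u0, mul_nonneg a0 (sub_nonneg.2 hs),
          mul_nonneg c1 (sub_nonneg.2 hs), mul_nonneg a0 c1]
      · have e1 : ¬ 1 ≤ |h x| := by
          rw [not_le, abs_lt]
          constructor <;> linarith
        rw [if_neg e1, if_neg h2, if_neg h1]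
        nlinarith [mul_nonneg a1 u0, mul_nonneg c0 u0, mul_nonneg a0 v0, mul_nonneg c1 v0]
  have hm : Measurable fun x => ENNReal.ofReal (pT x * l (-(h x)) + (1 - pT x) * l (h x)) := by
    fun_prop
  rw [← ENNReal.mul_le_mul_iff_right (a := 2) (by norm_num) (by norm_num)]
  rw [← lintegral_const_mul' _ _ (by norm_num)]
  refine le_trans (lintegral_mono (g := fun x =>
    ENNReal.ofReal (pT x * l (-(h x)) + (1 - pT x) * l (h x))
      + ENNReal.ofReal (pC x * l (h x) + (1 - pC x) * l (-(h x)))) ?_) ?_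
  · intro x
    refine le_trans (le_of_eq ?_) ((ENNReal.ofReal_le_ofReal (key x)).trans ENNReal.ofReal_add_le)
    rw [ENNReal.ofReal_mul (by norm_num)]
    simp
  · rw [lintegral_add_left hm, two_mul]
    exact add_le_add (le_max_left _ _) (le_max_right _ _)
end

section
/- Let l be a surrogate loss (a measurable function l : ℝ → [0, ∞) with l(z) ≥ 1{z ≥ 0} + 1{z ≥ 1} for all z ∈ ℝ). Then for every measurable predictor h : X → ℝ, the expected 0-1 conditional-difference loss is bounded by the maximum of the treatment and reweighted control surrogate risks: E[l_{0-1}](h) ≤ max( R_T(l, h), R_C(l, h) ). -/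
open MeasureTheory

theorem pointwise_bound (a c l1 l2 z : ℝ) (ha0 : 0 ≤ a) (ha1 : a ≤ 1) (hc0 : 0 ≤ c) (hc1 : c ≤ 1)
    (h10 : 0 ≤ l1) (h20 : 0 ≤ l2)
    (h1 : (if (0:ℝ) ≤ z then (1:ℝ) else 0) + (if (1:ℝ) ≤ z then (1:ℝ) else 0) ≤ l1)
    (h2 : (if (0:ℝ) ≤ -z then (1:ℝ) else 0) + (if (1:ℝ) ≤ -z then (1:ℝ) else 0) ≤ l2) :
    2 * ((a * c + (1 - a) * (1 - c)) * (if (1:ℝ) ≤ |z| then 1 else 0)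
          + a * (1 - c) * (if z ≤ 0 then 1 else 0)
          + (1 - a) * c * (if (0:ℝ) ≤ z then 1 else 0))
      ≤ (a * l2 + (1 - a) * l1) + (c * l1 + (1 - c) * l2) := by
  have hac := mul_nonneg ha0 hc0
  have hac1 := mul_nonneg ha0 (sub_nonneg.2 hc1)
  have hac2 := mul_nonneg (sub_nonneg.2 ha1) hc0
  have hac3 := mul_nonneg (sub_nonneg.2 ha1) (sub_nonneg.2 hc1)
  have key : ∀ u v : ℝ, u ≤ l1 → v ≤ l2 →
      (a + (1 - c)) * v + ((1 - a) + c) * u ≤ (a * l2 + (1 - a) * l1) + (c * l1 + (1 - c) * l2) := by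
    intro u v hu hv
    have e1 := mul_le_mul_of_nonneg_left hu (by linarith : 0 ≤ (1 - a) + c)
    have e2 := mul_le_mul_of_nonneg_left hv (by linarith : 0 ≤ a + (1 - c))
    linarith
  refine le_trans ?_ (key _ _ h1 h2)
  have n1 : (0:ℝ) ≤ -z ↔ z ≤ 0 := by constructor <;> intro <;> linarith
  simp only [le_abs, n1]
  split_ifs <;> first | nlinarith | (exfalso; grind)


/-- **Theorem (surrogate upper bound for the 0-1 conditional-difference loss `l_{0-1}`).**
`E[l_{0-1}](h) ≤ max (R_T(l,h)) (R_C(l,h))`. -/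
theorem expected_l01_le_max_surrogate_risks
    {X : Type*} [MeasurableSpace X] (μT : Measure X) [IsProbabilityMeasure μT]
    (pT pC : X → ℝ) (hpT : Measurable pT) (hpC : Measurable pC)
    (hpT0 : ∀ x, 0 ≤ pT x) (hpT1 : ∀ x, pT x ≤ 1)
    (hpC0 : ∀ x, 0 ≤ pC x) (hpC1 : ∀ x, pC x ≤ 1)
    (l : ℝ → ℝ) (hl : Measurable l) (hl0 : ∀ z, 0 ≤ l z)
    (hsur : ∀ z : ℝ, (if (0:ℝ) ≤ z then (1:ℝ) else 0) + (if (1:ℝ) ≤ z then (1:ℝ) else 0) ≤ l z)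
    (h : X → ℝ) (hh : Measurable h) :
    (∫⁻ x, ENNReal.ofReal
        ((pT x * pC x + (1 - pT x) * (1 - pC x)) * (if (1:ℝ) ≤ |h x| then 1 else 0)
          + pT x * (1 - pC x) * (if h x ≤ 0 then 1 else 0)
          + (1 - pT x) * pC x * (if (0:ℝ) ≤ h x then 1 else 0)) ∂μT)
      ≤ max
        (∫⁻ x, ENNReal.ofReal (pT x * l (-(h x)) + (1 - pT x) * l (h x)) ∂μT)
        (∫⁻ x, ENNReal.ofReal (pC x * l (h x) + (1 - pC x) * l (-(h x))) ∂μT) := by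
  rw [← ENNReal.mul_le_mul_iff_right (a := 2) (by norm_num) (by norm_num)]
  have n1 : ∀ x, 0 ≤ 1 - pT x := fun x => sub_nonneg.2 (hpT1 x)
  have n2 : ∀ x, 0 ≤ 1 - pC x := fun x => sub_nonneg.2 (hpC1 x)
  rw [← lintegral_const_mul' _ _ (by norm_num)]
  calc _ ≤ ∫⁻ x, (ENNReal.ofReal (pT x * l (-(h x)) + (1 - pT x) * l (h x))
        + ENNReal.ofReal (pC x * l (h x) + (1 - pC x) * l (-(h x)))) ∂μT := by
        refine lintegral_mono fun x => ?_
        have t1 := add_nonneg (mul_nonneg (hpT0 x) (hl0 (-(h x)))) (mul_nonneg (n1 x) (hl0 (h x)))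
        have t2 := add_nonneg (mul_nonneg (hpC0 x) (hl0 (h x))) (mul_nonneg (n2 x) (hl0 (-(h x))))
        have e2 : (2 : ENNReal) = ENNReal.ofReal 2 := by simp
        dsimp only
        rw [← ENNReal.ofReal_add t1 t2, e2, ← ENNReal.ofReal_mul (by norm_num)]
        exact ENNReal.ofReal_le_ofReal (pointwise_bound _ _ _ _ _ (hpT0 x) (hpT1 x) (hpC0 x)
          (hpC1 x) (hl0 _) (hl0 _) (hsur _) (hsur _))
    _ = _ := lintegral_add_left (by fun_prop) _
    _ ≤ _ := by
        rw [two_mul]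
        exact add_le_add (le_max_left _ _) (le_max_right _ _)
end

section
/- Let l be a surrogate loss (a measurable function l : ℝ → [0, ∞) with l(z) ≥ 1{z ≥ 0} + 1{z ≥ 1} for all z ∈ ℝ). Then for every measurable predictor h : X → ℝ, the expected conditional-difference loss is bounded by the sum of the treatment and reweighted control surrogate risks: E[l₁](h) ≤ R_T(l, h) + R_C(l, h); this is the looser bound corresponding to modeling treatment and control groups separately, since max(R_T(l,h), R_C(l,h)) ≤ R_T(l,h) + R_C(l,h). -/
open MeasureTheory

/-- **Theorem (looser sum bound).** `E[l₁](h) ≤ R_T(l,h) + R_C(l,h)`, and this bound is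
looser than the minimax bound since `max (R_T) (R_C) ≤ R_T + R_C`. -/
theorem expected_l1_le_sum_surrogate_risks
    {X : Type*} [MeasurableSpace X] (μT : Measure X) [IsProbabilityMeasure μT]
    (pT pC : X → ℝ) (hpT : Measurable pT) (hpC : Measurable pC)
    (hpT0 : ∀ x, 0 ≤ pT x) (hpT1 : ∀ x, pT x ≤ 1)
    (hpC0 : ∀ x, 0 ≤ pC x) (hpC1 : ∀ x, pC x ≤ 1)
    (l : ℝ → ℝ) (hl : Measurable l) (hl0 : ∀ z, 0 ≤ l z)
    (hsur : ∀ z : ℝ, (if (0:ℝ) ≤ z then (1:ℝ) else 0) + (if (1:ℝ) ≤ z then (1:ℝ) else 0) ≤ l z)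
    (h : X → ℝ) (hh : Measurable h) :
    (∫⁻ x, ENNReal.ofReal
        ((pT x * pC x + (1 - pT x) * (1 - pC x)) * (if (1:ℝ) ≤ |h x| then 1 else 0)
          + pT x * (1 - pC x) * (if h x ≤ -1 then 1 else 0)
          + (1 - pT x) * pC x * (if (1:ℝ) ≤ h x then 1 else 0)) ∂μT)
      ≤ (∫⁻ x, ENNReal.ofReal (pT x * l (-(h x)) + (1 - pT x) * l (h x)) ∂μT)
        + (∫⁻ x, ENNReal.ofReal (pC x * l (h x) + (1 - pC x) * l (-(h x))) ∂μT) ∧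
    max
        (∫⁻ x, ENNReal.ofReal (pT x * l (-(h x)) + (1 - pT x) * l (h x)) ∂μT)
        (∫⁻ x, ENNReal.ofReal (pC x * l (h x) + (1 - pC x) * l (-(h x))) ∂μT)
      ≤ (∫⁻ x, ENNReal.ofReal (pT x * l (-(h x)) + (1 - pT x) * l (h x)) ∂μT)
        + (∫⁻ x, ENNReal.ofReal (pC x * l (h x) + (1 - pC x) * l (-(h x))) ∂μT) := by
  refine ⟨?_, max_le le_self_add le_add_self⟩
  rw [← lintegral_add_left (by fun_prop)]
  refine lintegral_mono fun x => ?_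
  have ht0 := hpT0 x
  have ht1 : 0 ≤ 1 - pT x := sub_nonneg.2 (hpT1 x)
  have hc0 := hpC0 x
  have hc1 : 0 ≤ 1 - pC x := sub_nonneg.2 (hpC1 x)
  have hp := hl0 (h x)
  have hn := hl0 (-(h x))
  have hA := mul_nonneg ht0 hn
  have hB := mul_nonneg ht1 hp
  have hC := mul_nonneg hc0 hp
  have hD := mul_nonneg hc1 hn
  have hE := mul_nonneg ht1 hc0
  have hF := mul_nonneg ht0 hc1
  have sp := hsur (h x)
  have sn := hsur (-(h x))
  rw [← ENNReal.ofReal_add (by positivity) (by positivity)]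
  apply ENNReal.ofReal_le_ofReal
  by_cases h1 : 1 ≤ h x
  · have h2 : ¬ h x ≤ -1 := by linarith
    have h3 : 1 ≤ |h x| := h1.trans (le_abs_self _)
    have h0 : 0 ≤ h x := by linarith
    simp only [h1, h0, if_true] at sp
    simp only [h1, h2, h3, if_true, if_false]
    have := mul_le_mul_of_nonneg_left sp ht1
    have := mul_le_mul_of_nonneg_left sp hc0
    nlinarith
  · by_cases h2 : h x ≤ -1
    · have h3 : 1 ≤ |h x| := by linarith [neg_le_abs (h x)]
      have h0 : 0 ≤ -(h x) := by linarith
      have h4 : 1 ≤ -(h x) := by linarith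
      simp only [h4, h0, if_true] at sn
      simp only [h1, h2, h3, if_true, if_false]
      have := mul_le_mul_of_nonneg_left sn ht0
      have := mul_le_mul_of_nonneg_left sn hc1
      nlinarith
    · have h3 : ¬ 1 ≤ |h x| := by
        rw [not_le, abs_lt]
        exact ⟨not_le.1 h2, not_le.1 h1⟩
      simp only [h1, h2, h3, if_false]
      linarith
end

section
/- Let l be a surrogate loss (a measurable function l : ℝ → [0, ∞) with l(z) ≥ 1{z ≥ 0} + 1{z ≥ 1} for all z ∈ ℝ). Then for every measurable predictor h : X → ℝ, the treatment surrogate risk satisfies the lower bound: R_T(l, h) ≥ ∫ p_T(x)(1-p_C(x))·1{h(x) ≤ 0} dμ_T(x) + ∫ (1-p_T(x))p_C(x)·1{h(x) ≥ 0} dμ_T(x) + ∫ [p_T(x)p_C(x)·l(-h(x)) + (1-p_T(x))(1-p_C(x))·l(h(x))] dμ_T(x); here the three integrals are the contributions of the events Y^T > Y^C, Y^T < Y^C, and Y^T = Y^C respectively. -/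
open MeasureTheory

/-- **Lower bound on the treatment surrogate risk:** `R_T(l,h)` is at least the sum of the
contributions of the events `Y^T > Y^C`, `Y^T < Y^C`, and `Y^T = Y^C`. -/
theorem treatment_risk_lower_bound
    {X : Type*} [MeasurableSpace X] (μT : Measure X) [IsProbabilityMeasure μT]
    (pT pC : X → ℝ) (hpT : Measurable pT) (hpC : Measurable pC)
    (hpT0 : ∀ x, 0 ≤ pT x) (hpT1 : ∀ x, pT x ≤ 1)
    (hpC0 : ∀ x, 0 ≤ pC x) (hpC1 : ∀ x, pC x ≤ 1)
    (l : ℝ → ℝ) (hl : Measurable l) (hl0 : ∀ z, 0 ≤ l z)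
    (hsur : ∀ z : ℝ, (if (0:ℝ) ≤ z then (1:ℝ) else 0) + (if (1:ℝ) ≤ z then (1:ℝ) else 0) ≤ l z)
    (h : X → ℝ) (hh : Measurable h) :
    (∫⁻ x, ENNReal.ofReal (pT x * (1 - pC x) * (if h x ≤ 0 then 1 else 0)) ∂μT)
      + (∫⁻ x, ENNReal.ofReal ((1 - pT x) * pC x * (if (0:ℝ) ≤ h x then 1 else 0)) ∂μT)
      + (∫⁻ x, ENNReal.ofReal
          (pT x * pC x * l (-(h x)) + (1 - pT x) * (1 - pC x) * l (h x)) ∂μT)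
      ≤ ∫⁻ x, ENNReal.ofReal (pT x * l (-(h x)) + (1 - pT x) * l (h x)) ∂μT := by
  refine (add_le_add_left (le_lintegral_add _ _) _).trans ((le_lintegral_add _ _).trans ?_)
  refine lintegral_mono fun x => ?_
  have a0 := hpT0 x
  have a1 : 0 ≤ 1 - pT x := sub_nonneg.2 (hpT1 x)
  have b0 := hpC0 x
  have b1 : 0 ≤ 1 - pC x := sub_nonneg.2 (hpC1 x)
  have l1 := hl0 (h x)
  have l2 := hl0 (-(h x))
  have e1 : (if h x ≤ 0 then (1:ℝ) else 0) ≤ l (-(h x)) := by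
    have := hsur (-(h x))
    split_ifs at this ⊢ <;> linarith
  have e2 : (if (0:ℝ) ≤ h x then (1:ℝ) else 0) ≤ l (h x) := by
    have := hsur (h x)
    split_ifs at this ⊢ <;> linarith
  have i1 : (0:ℝ) ≤ (if h x ≤ 0 then (1:ℝ) else 0) := by split_ifs <;> norm_num
  have i2 : (0:ℝ) ≤ (if (0:ℝ) ≤ h x then (1:ℝ) else 0) := by split_ifs <;> norm_num
  have p1 := mul_nonneg (mul_nonneg a0 b1) i1
  have p2 := mul_nonneg (mul_nonneg a1 b0) i2
  have p3 : 0 ≤ pT x * pC x * l (-(h x)) + (1 - pT x) * (1 - pC x) * l (h x) := by positivity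
  have m1 := mul_le_mul_of_nonneg_left e1 (mul_nonneg a0 b1)
  have m2 := mul_le_mul_of_nonneg_left e2 (mul_nonneg a1 b0)
  change ENNReal.ofReal _ + ENNReal.ofReal _ + ENNReal.ofReal _ ≤ ENNReal.ofReal _
  rw [← ENNReal.ofReal_add p1 p2, ← ENNReal.ofReal_add (add_nonneg p1 p2) p3]
  apply ENNReal.ofReal_le_ofReal
  linarith
end

section
/- Let l be a surrogate loss (a measurable function l : ℝ → [0, ∞) with l(z) ≥ 1{z ≥ 0} + 1{z ≥ 1} for all z ∈ ℝ). Then for every measurable predictor h : X → ℝ, the reweighted control surrogate risk satisfies the lower bound: R_C(l, h) ≥ ∫ p_T(x)(1-p_C(x))·1{h(x) ≤ 0} dμ_T(x) + ∫ (1-p_T(x))p_C(x)·1{h(x) ≥ 0} dμ_T(x) + ∫ [p_T(x)p_C(x)·l(h(x)) + (1-p_T(x))(1-p_C(x))·l(-h(x))] dμ_T(x); here the three integrals are the contributions of the events Y^T > Y^C, Y^T < Y^C, and Y^T = Y^C respectively. -/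
open MeasureTheory

/-- **Lower bound on the reweighted control surrogate risk:** `R_C(l,h)` is at least the
sum of the contributions of the events `Y^T > Y^C`, `Y^T < Y^C`, and `Y^T = Y^C`. -/
theorem control_risk_lower_bound
    {X : Type*} [MeasurableSpace X] (μT : Measure X) [IsProbabilityMeasure μT]
    (pT pC : X → ℝ) (hpT : Measurable pT) (hpC : Measurable pC)
    (hpT0 : ∀ x, 0 ≤ pT x) (hpT1 : ∀ x, pT x ≤ 1)
    (hpC0 : ∀ x, 0 ≤ pC x) (hpC1 : ∀ x, pC x ≤ 1)
    (l : ℝ → ℝ) (hl : Measurable l) (hl0 : ∀ z, 0 ≤ l z)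
    (hsur : ∀ z : ℝ, (if (0:ℝ) ≤ z then (1:ℝ) else 0) + (if (1:ℝ) ≤ z then (1:ℝ) else 0) ≤ l z)
    (h : X → ℝ) (hh : Measurable h) :
    (∫⁻ x, ENNReal.ofReal (pT x * (1 - pC x) * (if h x ≤ 0 then 1 else 0)) ∂μT)
      + (∫⁻ x, ENNReal.ofReal ((1 - pT x) * pC x * (if (0:ℝ) ≤ h x then 1 else 0)) ∂μT)
      + (∫⁻ x, ENNReal.ofReal
          (pT x * pC x * l (h x) + (1 - pT x) * (1 - pC x) * l (-(h x))) ∂μT)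
      ≤ ∫⁻ x, ENNReal.ofReal (pC x * l (h x) + (1 - pC x) * l (-(h x))) ∂μT := by
  refine (add_le_add (le_lintegral_add _ _) le_rfl).trans ((le_lintegral_add _ _).trans ?_)
  refine lintegral_mono fun x => ?_
  have a0 := hpT0 x
  have a1 : 0 ≤ 1 - pT x := sub_nonneg.2 (hpT1 x)
  have b0 := hpC0 x
  have b1 : 0 ≤ 1 - pC x := sub_nonneg.2 (hpC1 x)
  have c0 := hl0 (h x)
  have c1 := hl0 (-(h x))
  have i1 : (0:ℝ) ≤ if h x ≤ 0 then 1 else 0 := by split_ifs <;> norm_num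
  have i2 : (0:ℝ) ≤ if (0:ℝ) ≤ h x then 1 else 0 := by split_ifs <;> norm_num
  have e1 : (if h x ≤ 0 then (1:ℝ) else 0) ≤ l (-(h x)) := by
    have := hsur (-(h x))
    have j : (0:ℝ) ≤ if (1:ℝ) ≤ -(h x) then 1 else 0 := by split_ifs <;> norm_num
    simp only [neg_nonneg] at this
    linarith
  have e2 : (if (0:ℝ) ≤ h x then (1:ℝ) else 0) ≤ l (h x) := by
    have := hsur (h x)
    have j : (0:ℝ) ≤ if (1:ℝ) ≤ h x then 1 else 0 := by split_ifs <;> norm_num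
    linarith
  have n1 := mul_nonneg (mul_nonneg a0 b1) i1
  have n2 := mul_nonneg (mul_nonneg a1 b0) i2
  have n3 := add_nonneg (mul_nonneg (mul_nonneg a0 b0) c0) (mul_nonneg (mul_nonneg a1 b1) c1)
  have m1 := mul_le_mul_of_nonneg_left e1 (mul_nonneg a0 b1)
  have m2 := mul_le_mul_of_nonneg_left e2 (mul_nonneg a1 b0)
  show ENNReal.ofReal _ + ENNReal.ofReal _ + ENNReal.ofReal _ ≤ ENNReal.ofReal _
  rw [← ENNReal.ofReal_add n1 n2, ← ENNReal.ofReal_add (add_nonneg n1 n2) n3]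
  apply ENNReal.ofReal_le_ofReal
  refine (add_le_add (add_le_add m1 m2) le_rfl).trans (le_of_eq ?_)
  ring
end

section
/- Let l be a surrogate loss (a measurable function l : ℝ → [0, ∞) with l(z) ≥ 1{z ≥ 0} + 1{z ≥ 1} for all z ∈ ℝ). Then for every measurable predictor h : X → ℝ: max( ∫ [p_T(x)p_C(x)·l(-h(x)) + (1-p_T(x))(1-p_C(x))·l(h(x))] dμ_T(x), ∫ [p_T(x)p_C(x)·l(h(x)) + (1-p_T(x))(1-p_C(x))·l(-h(x))] dμ_T(x) ) ≥ ∫ (p_T(x)p_C(x) + (1-p_T(x))(1-p_C(x)))·1{|h(x)| ≥ 1} dμ_T(x); that is, the maximum of the expected treatment and control surrogate losses restricted to the event Y^T = Y^C is at least P(Y^T = Y^C, |h(X)| ≥ 1). -/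
open MeasureTheory

/-- **Lower bound on the maximum of the restricted surrogate losses:** the maximum of the
expected treatment and control surrogate losses restricted to the event `Y^T = Y^C`
is at least `P(Y^T = Y^C, |h(X)| ≥ 1)`. -/
theorem max_equal_outcomes_lower_bound
    {X : Type*} [MeasurableSpace X] (μT : Measure X) [IsProbabilityMeasure μT]
    (pT pC : X → ℝ) (hpT : Measurable pT) (hpC : Measurable pC)
    (hpT0 : ∀ x, 0 ≤ pT x) (hpT1 : ∀ x, pT x ≤ 1)
    (hpC0 : ∀ x, 0 ≤ pC x) (hpC1 : ∀ x, pC x ≤ 1)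
    (l : ℝ → ℝ) (hl : Measurable l) (hl0 : ∀ z, 0 ≤ l z)
    (hsur : ∀ z : ℝ, (if (0:ℝ) ≤ z then (1:ℝ) else 0) + (if (1:ℝ) ≤ z then (1:ℝ) else 0) ≤ l z)
    (h : X → ℝ) (hh : Measurable h) :
    (∫⁻ x, ENNReal.ofReal
        ((pT x * pC x + (1 - pT x) * (1 - pC x)) * (if (1:ℝ) ≤ |h x| then 1 else 0)) ∂μT)
      ≤ max
        (∫⁻ x, ENNReal.ofReal
          (pT x * pC x * l (-(h x)) + (1 - pT x) * (1 - pC x) * l (h x)) ∂μT)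
        (∫⁻ x, ENNReal.ofReal
          (pT x * pC x * l (h x) + (1 - pT x) * (1 - pC x) * l (-(h x))) ∂μT) := by
  by_contra hcon
  rw [not_le, max_lt_iff] at hcon
  have hlt := ENNReal.add_lt_add hcon.1 hcon.2
  refine absurd hlt (not_lt.mpr ?_)
  have hm : Measurable (fun x => ENNReal.ofReal
      ((pT x * pC x + (1 - pT x) * (1 - pC x)) * (if (1:ℝ) ≤ |h x| then 1 else 0))) := by
    have hs : MeasurableSet {x | (1:ℝ) ≤ |h x|} :=
      measurableSet_le measurable_const (by simpa using hh.norm)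
    have hi : Measurable (fun x => if (1:ℝ) ≤ |h x| then (1:ℝ) else 0) :=
      Measurable.ite hs measurable_const measurable_const
    fun_prop
  have hm2 : Measurable (fun x => ENNReal.ofReal
          (pT x * pC x * l (-(h x)) + (1 - pT x) * (1 - pC x) * l (h x))) := by
    fun_prop
  rw [← lintegral_add_left hm, ← lintegral_add_left hm2]
  refine lintegral_mono fun x => ?_
  have ha : 0 ≤ pT x * pC x := mul_nonneg (hpT0 x) (hpC0 x)
  have hb : 0 ≤ (1 - pT x) * (1 - pC x) :=
    mul_nonneg (sub_nonneg.mpr (hpT1 x)) (sub_nonneg.mpr (hpC1 x))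
  have h1 := hl0 (h x)
  have h2 := hl0 (-(h x))
  have key : 2 * (if (1:ℝ) ≤ |h x| then (1:ℝ) else 0) ≤ l (h x) + l (-(h x)) := by
    split_ifs with hc
    · rcases le_abs.mp hc with h3 | h3
      · have := hsur (h x)
        rw [if_pos (by linarith), if_pos h3] at this
        linarith
      · have := hsur (-(h x))
        rw [if_pos (by linarith), if_pos h3] at this
        linarith
    · linarith
  have hi : (0:ℝ) ≤ (if (1:ℝ) ≤ |h x| then (1:ℝ) else 0) := by split_ifs <;> norm_num
  generalize (if (1:ℝ) ≤ |h x| then (1:ℝ) else 0) = t at key hi ⊢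
  generalize pT x * pC x = a at ha ⊢
  generalize (1 - pT x) * (1 - pC x) = b at hb ⊢
  simp only []
  rw [← ENNReal.ofReal_add (by positivity) (by positivity),
    ← ENNReal.ofReal_add (by positivity) (by positivity)]
  apply ENNReal.ofReal_le_ofReal
  nlinarith [mul_le_mul_of_nonneg_left key (add_nonneg ha hb)]
end
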